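/- arXiv:1707.00868 — 6 statements merged into one kernel-verified Lean document; each statement's English description precedes it below -/
import Mathlib

section
/- Let 𝒜 be a pointed category (zero object) with finite limits in which regular epimorphisms are stable under pullback, and assume 𝒜 is protomodular in the pointed sense: for every split epimorphism p : E ⟶ Y with a section s : Y ⟶ E and kernel k : K ⟶ E, the pair (k, s) is jointly strongly epimorphic. Then for every commutative square f ≫ b = a ≫ f₀ (with f : A ⟶ B, f₀ : A₀ ⟶ B₀, a : A ⟶ A₀, b : B ⟶ B₀) in which f is a regular epimorphism, the two canonical morphisms into the pullback P = A₀ ×_{f₀,b} B — namely ⟨kernel.ι f₀, 0⟩ : Ker f₀ ⟶ P and ⟨a, f⟩ : A ⟶ P — are jointly strongly epimorphic. -/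
open CategoryTheory CategoryTheory.Limits

/-- A pair of morphisms with common codomain is *jointly strongly epimorphic* if every
monomorphism through which both factor is an isomorphism. -/
def JointlyStronglyEpi {C : Type*} [Category C] {X₁ X₂ Y : C}
    (g₁ : X₁ ⟶ Y) (g₂ : X₂ ⟶ Y) : Prop :=
  ∀ ⦃M : C⦄ (m : M ⟶ Y), Mono m → (∃ h₁ : X₁ ⟶ M, h₁ ≫ m = g₁) →
    (∃ h₂ : X₂ ⟶ M, h₂ ≫ m = g₂) → IsIso m

/-- In a pointed, finitely complete category in which regular epimorphisms are stable
under pullback and which is protomodular (kernel and section of any split epimorphism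
are jointly strongly epimorphic), for every commutative square `f ≫ b = a ≫ f₀` with `f`
a regular epimorphism, the canonical morphisms `⟨kernel.ι f₀, 0⟩` and `⟨a, f⟩` into the
pullback `A₀ ×_{f₀, b} B` are jointly strongly epimorphic. -/
theorem stmt0 {𝒜 : Type*} [Category 𝒜] [HasZeroObject 𝒜] [HasZeroMorphisms 𝒜]
    [HasFiniteLimits 𝒜]
    (hstab : ∀ ⦃X Y Z : 𝒜⦄ (g : X ⟶ Z) (h : Y ⟶ Z), Nonempty (RegularEpi h) →
      Nonempty (RegularEpi (pullback.fst g h)))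
    (hproto : ∀ ⦃E Y : 𝒜⦄ (p : E ⟶ Y) (s : Y ⟶ E), s ≫ p = 𝟙 Y →
      JointlyStronglyEpi (kernel.ι p) s)
    {A B A₀ B₀ : 𝒜} (f : A ⟶ B) (f₀ : A₀ ⟶ B₀) (a : A ⟶ A₀) (b : B ⟶ B₀)
    (comm : f ≫ b = a ≫ f₀) (hf : Nonempty (RegularEpi f)) :
    JointlyStronglyEpi
      (pullback.lift (kernel.ι f₀) 0 (by simp) : kernel f₀ ⟶ pullback f₀ b)
      (pullback.lift a f comm.symm) := by
  rintro M m _ ⟨h₁, hh₁⟩ ⟨h₂, hh₂⟩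
  let q := pullback.fst (pullback.snd f₀ b) f
  let p := pullback.snd (pullback.snd f₀ b) f
  let s : A ⟶ pullback (pullback.snd f₀ b) f :=
    pullback.lift (pullback.lift a f comm.symm) (𝟙 A)
      (by rw [pullback.lift_snd, Category.id_comp])
  obtain ⟨hq⟩ : Nonempty (RegularEpi q) := hstab _ f hf
  have cond : q ≫ pullback.snd f₀ b = p ≫ f := pullback.condition
  have hker : (kernel.ι p ≫ q ≫ pullback.fst f₀ b) ≫ f₀ = 0 := by
    rw [Category.assoc, Category.assoc, pullback.condition, reassoc_of% cond,
      kernel.condition_assoc, zero_comp]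
  have hfac : kernel.lift f₀ _ hker ≫ h₁ ≫ m = kernel.ι p ≫ q := by
    rw [hh₁]
    apply pullback.hom_ext
    · rw [Category.assoc, pullback.lift_fst, kernel.lift_ι, Category.assoc]
    · rw [Category.assoc, pullback.lift_snd, comp_zero, Category.assoc, cond,
        kernel.condition_assoc, zero_comp]
  have : IsIso (pullback.fst q m) := by
    refine hproto p s (pullback.lift_snd _ _ _) (pullback.fst q m) inferInstance
      ⟨pullback.lift (kernel.ι p) (kernel.lift f₀ _ hker ≫ h₁) ?_, pullback.lift_fst _ _ _⟩
      ⟨pullback.lift s h₂ ?_, pullback.lift_fst _ _ _⟩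
    · simpa using hfac.symm
    · rw [hh₂, pullback.lift_fst]
  have : IsRegularEpi q := ⟨⟨hq⟩⟩
  have : StrongEpi ((inv (pullback.fst q m) ≫ pullback.snd q m) ≫ m) := by
    rw [Category.assoc, ← pullback.condition, IsIso.inv_hom_id_assoc]
    infer_instance
  have : StrongEpi m := strongEpi_of_strongEpi (inv (pullback.fst q m) ≫ pullback.snd q m) m
  exact isIso_of_mono_of_strongEpi m
end

section
/- Let 𝒜 be a pointed category (zero object) with finite limits. Assume that for every commutative square f ≫ b = a ≫ f₀ (with f : A ⟶ B, f₀ : A₀ ⟶ B₀, a : A ⟶ A₀, b : B ⟶ B₀) in which f is a regular epimorphism, the morphisms ⟨kernel.ι f₀, 0⟩ : Ker f₀ ⟶ A₀ ×_{f₀,b} B and ⟨a, f⟩ : A ⟶ A₀ ×_{f₀,b} B are jointly strongly epimorphic. Then every morphism g : X ⟶ Y of 𝒜 whose kernel is a zero object (equivalently, kernel.ι g = 0) is a monomorphism. -/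
open CategoryTheory CategoryTheory.Limits

/-- If in a pointed finitely complete category, for every commutative square
`f ≫ b = a ≫ f₀` with `f` a regular epimorphism the morphisms `⟨kernel.ι f₀, 0⟩` and
`⟨a, f⟩` into the pullback `A₀ ×_{f₀, b} B` are jointly strongly epimorphic, then every
morphism with zero kernel is a monomorphism. -/
theorem stmt1 {𝒜 : Type*} [Category 𝒜] [HasZeroObject 𝒜] [HasZeroMorphisms 𝒜]
    [HasFiniteLimits 𝒜]
    (hyp : ∀ {A B A₀ B₀ : 𝒜} (f : A ⟶ B) (f₀ : A₀ ⟶ B₀) (a : A ⟶ A₀) (b : B ⟶ B₀)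
      (comm : f ≫ b = a ≫ f₀), Nonempty (RegularEpi f) →
      JointlyStronglyEpi
        (pullback.lift (kernel.ι f₀) 0 (by simp) : kernel f₀ ⟶ pullback f₀ b)
        (pullback.lift a f comm.symm))
    {X Y : 𝒜} (g : X ⟶ Y) (hg : kernel.ι g = 0) : Mono g := by
  have hdiag : IsIso (pullback.diagonal g) := by
    refine hyp (𝟙 X) g (𝟙 X) g rfl ⟨RegularEpi.ofIso (Iso.refl X)⟩ (pullback.diagonal g)
      inferInstance ⟨0, ?_⟩ ⟨𝟙 X, Category.id_comp _⟩
    ext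
    · rw [zero_comp, zero_comp, pullback.lift_fst, hg]
    · rw [zero_comp, zero_comp, pullback.lift_snd]
  exact (pullback.isIso_diagonal_iff g).1 hdiag
end

section
/- Let 𝒜 be a pointed category (zero object) with finite limits. Assume that for every commutative square f ≫ b = a ≫ f₀ (with f : A ⟶ B, f₀ : A₀ ⟶ B₀, a : A ⟶ A₀, b : B ⟶ B₀) in which f is a regular epimorphism, the morphisms ⟨kernel.ι f₀, 0⟩ : Ker f₀ ⟶ A₀ ×_{f₀,b} B and ⟨a, f⟩ : A ⟶ A₀ ×_{f₀,b} B are jointly strongly epimorphic. Then the Short Five Lemma holds in 𝒜: given regular epimorphisms f : A ⟶ B and f₀ : A₀ ⟶ B₀ with kernels k_f : Ker f ⟶ A and k_{f₀} : Ker f₀ ⟶ A₀, and morphisms a : A ⟶ A₀, b : B ⟶ B₀, u : Ker f ⟶ Ker f₀ satisfying u ≫ k_{f₀} = k_f ≫ a and f ≫ b = a ≫ f₀, if u and b are isomorphisms then a is an isomorphism. -/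
open CategoryTheory CategoryTheory.Limits

/-- A morphism `a` with trivial kernel is a monomorphism, provided that for every split
epimorphism `p` with section `s`, the kernel of `p` and `s` are jointly strongly epimorphic. -/
theorem mono_of_forall_comp_eq_zero {C : Type*} [Category C] [HasZeroMorphisms C]
    [HasFiniteLimits C]
    (hyp : ∀ {X Y : C} (p : X ⟶ Y) (s : Y ⟶ X), s ≫ p = 𝟙 Y →
      JointlyStronglyEpi (kernel.ι p) s)
    {A A₀ : C} (a : A ⟶ A₀) (ha : ∀ {K : C} (k : K ⟶ A), k ≫ a = 0 → k = 0) : Mono a := by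
  have hs : IsIso (pullback.diagonal a) := by
    refine hyp (pullback.fst a a) (pullback.diagonal a) (by simp) _ inferInstance ⟨0, ?_⟩
      ⟨𝟙 A, by simp⟩
    have hk : kernel.ι (pullback.fst a a) ≫ pullback.snd a a = 0 := by
      apply ha
      rw [Category.assoc, ← pullback.condition, kernel.condition_assoc, zero_comp]
    apply pullback.hom_ext <;> simp [hk]
  have hp : pullback.fst a a = pullback.snd a a := by
    simp [← cancel_epi (pullback.diagonal a)]
  refine ⟨fun g h w => ?_⟩
  rw [← pullback.lift_fst g h w, hp, pullback.lift_snd]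

/-- Being jointly strongly epimorphic is stable under postcomposition with isomorphisms. -/
theorem JointlyStronglyEpi.comp_isIso {C : Type*} [Category C] {X₁ X₂ Y Z : C}
    {g₁ : X₁ ⟶ Y} {g₂ : X₂ ⟶ Y} (h : JointlyStronglyEpi g₁ g₂) (e : Y ⟶ Z) [IsIso e] :
    JointlyStronglyEpi (g₁ ≫ e) (g₂ ≫ e) := by
  rintro M m hm ⟨h₁, w₁⟩ ⟨h₂, w₂⟩
  have : IsIso (m ≫ inv e) :=
    h (m ≫ inv e) inferInstance ⟨h₁, by simp [reassoc_of% w₁]⟩ ⟨h₂, by simp [reassoc_of% w₂]⟩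
  exact IsIso.of_isIso_comp_right m (inv e)

/-- If in a pointed finitely complete category, for every commutative square
`f ≫ b = a ≫ f₀` with `f` a regular epimorphism the morphisms `⟨kernel.ι f₀, 0⟩` and
`⟨a, f⟩` into the pullback `A₀ ×_{f₀, b} B` are jointly strongly epimorphic, then the
Short Five Lemma holds: for regular epimorphisms `f`, `f₀` and a morphism of exact rows
`(u, a, b)`, if `u` and `b` are isomorphisms, then so is `a`. -/
theorem stmt2 {𝒜 : Type*} [Category 𝒜] [HasZeroObject 𝒜] [HasZeroMorphisms 𝒜]
    [HasFiniteLimits 𝒜]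
    (hyp : ∀ {A B A₀ B₀ : 𝒜} (f : A ⟶ B) (f₀ : A₀ ⟶ B₀) (a : A ⟶ A₀) (b : B ⟶ B₀)
      (comm : f ≫ b = a ≫ f₀), Nonempty (RegularEpi f) →
      JointlyStronglyEpi
        (pullback.lift (kernel.ι f₀) 0 (by simp) : kernel f₀ ⟶ pullback f₀ b)
        (pullback.lift a f comm.symm))
    {A B A₀ B₀ : 𝒜} (f : A ⟶ B) (f₀ : A₀ ⟶ B₀)
    (hf : Nonempty (RegularEpi f)) (hf₀ : Nonempty (RegularEpi f₀))
    (a : A ⟶ A₀) (b : B ⟶ B₀) (u : kernel f ⟶ kernel f₀)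
    (hu : u ≫ kernel.ι f₀ = kernel.ι f ≫ a) (comm : f ≫ b = a ≫ f₀)
    (hui : IsIso u) (hbi : IsIso b) : IsIso a := by
  have key : ∀ {A B A₀ B₀ : 𝒜} (f : A ⟶ B) (f₀ : A₀ ⟶ B₀) (a : A ⟶ A₀) (b : B ⟶ B₀),
      f ≫ b = a ≫ f₀ → Nonempty (RegularEpi f) → IsIso b →
      JointlyStronglyEpi (kernel.ι f₀) a := by
    intro A B A₀ B₀ f f₀ a b comm hf hb
    have h := (hyp f f₀ a b comm hf).comp_isIso (pullback.fst f₀ b)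
    rwa [pullback.lift_fst, pullback.lift_fst] at h
  have ha : Mono a := by
    refine mono_of_forall_comp_eq_zero
      (fun p s w => key (𝟙 _) p s (𝟙 _) (by simp [w]) ⟨RegularEpi.ofSplitEpi _⟩ inferInstance)
      a fun k hk => ?_
    have hkf : k ≫ f = 0 := by
      rw [← cancel_mono b, Category.assoc, comm, reassoc_of% hk, zero_comp, zero_comp]
    have hx : kernel.lift f k hkf = 0 := by
      rw [← cancel_mono u, ← cancel_mono (kernel.ι f₀)]
      simp [hu, hk]
    rw [← kernel.lift_ι f k hkf, hx, zero_comp]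
  exact key f f₀ a b comm hf hbi a ha ⟨inv u ≫ kernel.ι f, by simp [← hu]⟩
    ⟨𝟙 A, Category.id_comp a⟩
end

section
/- Let 𝒜 be a pointed category (zero object) with kernels and pullbacks. Given a commutative square f ≫ b = a ≫ f₀ (with f : A ⟶ B, f₀ : A₀ ⟶ B₀, a : A ⟶ A₀, b : B ⟶ B₀), let k_f : Ker f ⟶ A and k_{f₀} : Ker f₀ ⟶ A₀ be kernels, let K(a) : Ker f ⟶ Ker f₀ be the induced morphism (the unique one with K(a) ≫ k_{f₀} = k_f ≫ a), let P = A₀ ×_{f₀,b} B be the pullback, let ∂ = ⟨a, f⟩ : A ⟶ P and ι = ⟨k_{f₀}, 0⟩ : Ker f₀ ⟶ P. Then the commutative square with sides k_f : Ker f ⟶ A, K(a) : Ker f ⟶ Ker f₀, ∂ : A ⟶ P, ι : Ker f₀ ⟶ P (i.e., k_f ≫ ∂ = K(a) ≫ ι) is a pullback square. -/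
open CategoryTheory CategoryTheory.Limits

/-- Kernels in the arrow category are strong: for a commutative square `f ≫ b = a ≫ f₀`
in a pointed category with kernels and pullbacks, the square formed by `kernel.ι f`,
the induced morphism `kernel f ⟶ kernel f₀`, the comparison `⟨a, f⟩ : A ⟶ A₀ ×_{f₀,b} B`
and `⟨kernel.ι f₀, 0⟩ : kernel f₀ ⟶ A₀ ×_{f₀,b} B` is a pullback. -/
theorem stmt3 {𝒜 : Type*} [Category 𝒜] [HasZeroObject 𝒜] [HasZeroMorphisms 𝒜]
    [HasKernels 𝒜] [HasPullbacks 𝒜]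
    {A B A₀ B₀ : 𝒜} (f : A ⟶ B) (f₀ : A₀ ⟶ B₀) (a : A ⟶ A₀) (b : B ⟶ B₀)
    (comm : f ≫ b = a ≫ f₀) :
    IsPullback (kernel.ι f) (kernel.map f f₀ a b comm)
      (pullback.lift a f comm.symm)
      (pullback.lift (kernel.ι f₀) 0 (by simp) : kernel f₀ ⟶ pullback f₀ b) := by
  have w : kernel.ι f ≫ pullback.lift a f comm.symm =
      kernel.map f f₀ a b comm ≫ pullback.lift (kernel.ι f₀) 0 (by simp) := by
    apply pullback.hom_ext <;> simp [kernel.map, pullback.lift_fst, pullback.lift_snd]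
  refine ⟨⟨w⟩, ⟨PullbackCone.IsLimit.mk w (fun s => kernel.lift f s.fst ?_) ?_ ?_ ?_⟩⟩
  · simpa [pullback.lift_snd] using s.condition =≫ pullback.snd f₀ b
  · intro s
    simp
  · intro s
    have h := s.condition =≫ pullback.fst f₀ b
    simp only [Category.assoc, pullback.lift_fst] at h
    simp [← cancel_mono (kernel.ι f₀), kernel.map, h]
  · intro s m hm _
    simp [← cancel_mono (kernel.ι f), hm]
end

section
/- Let A and B be groupoids and F : A ⥤ B a functor. Let V(F) be the groupoid whose objects are triples (b, a, β) with b an object of B, a an object of A and β : b ⟶ F.obj a, and whose morphisms (b, a, β) ⟶ (b', a', β') exist only when b = b' and are the morphisms α : a ⟶ a' of A with β ≫ F.map α = β'. Let P be the groupoid whose objects are the objects of A and whose morphisms a ⟶ a' are the morphisms α : a ⟶ a' of A for which there is an equality h : F.obj a = F.obj a' with F.map α = eqToHom h. Let T : P ⥤ V(F) be the functor sending a to (F.obj a, a, 𝟙 (F.obj a)) and α to α. Then: (i) T is fully faithful; (ii) T is essentially surjective if and only if F is star-surjective. -/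
open CategoryTheory

universe v₁ u₁ v₂ u₂

variable {A : Type u₁} [Groupoid.{v₁} A] {B : Type u₂} [Groupoid.{v₂} B]

/-- Objects of the groupoid `V(F)`: triples `(b, a, β)` with `b` an object of `B`, `a`
an object of `A` and `β : b ⟶ F.obj a`. -/
structure VObj (F : A ⥤ B) where
  pt : B
  base : A
  hom : pt ⟶ F.obj base

/-- The groupoid `V(F)`: morphisms `(b, a, β) ⟶ (b', a', β')` exist only when `b = b'`
and are the morphisms `α : a ⟶ a'` of `A` with `β ≫ F.map α = β'` (modulo the equality
`b = b'`). -/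
instance VObj.groupoid (F : A ⥤ B) : Groupoid (VObj F) where
  Hom X Y := { α : X.base ⟶ Y.base //
    ∃ h : X.pt = Y.pt, X.hom ≫ F.map α = eqToHom h ≫ Y.hom }
  id X := ⟨𝟙 X.base, rfl, by simp⟩
  comp {X Y Z} α β := ⟨α.1 ≫ β.1, by
    obtain ⟨h1, e1⟩ := α.2
    obtain ⟨h2, e2⟩ := β.2
    exact ⟨h1.trans h2, by
      rw [Functor.map_comp, ← Category.assoc, e1, Category.assoc, e2,
        eqToHom_trans_assoc]⟩⟩
  id_comp α := Subtype.ext (Category.id_comp α.1)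
  comp_id α := Subtype.ext (Category.comp_id α.1)
  assoc α β γ := Subtype.ext (Category.assoc α.1 β.1 γ.1)
  inv {X Y} α := ⟨Groupoid.inv α.1, by
    obtain ⟨h, e⟩ := α.2
    refine ⟨h.symm, ?_⟩
    rw [Groupoid.inv_eq_inv, Functor.map_inv, IsIso.comp_inv_eq, Category.assoc, e]
    simp⟩
  inv_comp α := Subtype.ext (by simp [Groupoid.inv_eq_inv])
  comp_inv α := Subtype.ext (by simp [Groupoid.inv_eq_inv])

/-- Objects of the groupoid `P`: the objects of `A`. -/
structure PObj (F : A ⥤ B) where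
  base : A

/-- The groupoid `P`: morphisms `a ⟶ a'` are the morphisms `α : a ⟶ a'` of `A` such
that `F.map α = eqToHom h` for some equality `h : F.obj a = F.obj a'`. -/
instance PObj.groupoid (F : A ⥤ B) : Groupoid (PObj F) where
  Hom a a' := { α : a.base ⟶ a'.base //
    ∃ h : F.obj a.base = F.obj a'.base, F.map α = eqToHom h }
  id a := ⟨𝟙 a.base, rfl, by simp⟩
  comp {a a' a''} α β := ⟨α.1 ≫ β.1, by
    obtain ⟨h1, e1⟩ := α.2
    obtain ⟨h2, e2⟩ := β.2
    exact ⟨h1.trans h2, by rw [Functor.map_comp, e1, e2, eqToHom_trans]⟩⟩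
  id_comp α := Subtype.ext (Category.id_comp α.1)
  comp_id α := Subtype.ext (Category.comp_id α.1)
  assoc α β γ := Subtype.ext (Category.assoc α.1 β.1 γ.1)
  inv {a a'} α := ⟨Groupoid.inv α.1, by
    obtain ⟨h, e⟩ := α.2
    refine ⟨h.symm, ?_⟩
    have hinv : inv (F.map α.1) = eqToHom h.symm := by
      apply IsIso.inv_eq_of_hom_inv_id
      rw [e]; simp
    rw [Groupoid.inv_eq_inv, Functor.map_inv, hinv]⟩
  inv_comp α := Subtype.ext (by simp [Groupoid.inv_eq_inv])
  comp_inv α := Subtype.ext (by simp [Groupoid.inv_eq_inv])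

/-- The comparison functor `T : P ⥤ V(F)`, sending `a` to `(F.obj a, a, 𝟙 (F.obj a))`
and `α` to `α`. -/
def Tcomp (F : A ⥤ B) : PObj F ⥤ VObj F where
  obj a := ⟨F.obj a.base, a.base, 𝟙 (F.obj a.base)⟩
  map {a a'} α := ⟨α.1, by
    obtain ⟨h, e⟩ := α.2
    exact ⟨h, by simp [e]⟩⟩
  map_id a := rfl
  map_comp α β := rfl

/-- A functor between groupoids is star-surjective (a fibration) if every morphism
starting at a value of `F` lifts along `F`, up to an equality of objects. -/
def StarSurjective (F : A ⥤ B) : Prop :=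
  ∀ (a : A) ⦃b : B⦄ (β : F.obj a ⟶ b),
    ∃ (a' : A) (α : a ⟶ a') (h : F.obj a' = b), F.map α ≫ eqToHom h = β

/-- The comparison functor `T : P ⥤ V(F)` from the pullback to the strong homotopy
pullback is fully faithful, and it is essentially surjective if and only if `F` is
star-surjective (a fibration). -/
theorem stmt4 (F : A ⥤ B) :
    (Tcomp F).Full ∧ (Tcomp F).Faithful ∧
      ((Tcomp F).EssSurj ↔ StarSurjective F) := by
  refine ⟨⟨fun {a a'} α => ?_⟩, ⟨fun {a a'} α β e => ?_⟩, fun hT a b β => ?_, fun hF => ⟨fun X => ?_⟩⟩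
  · obtain ⟨α, h, e⟩ := α
    exact ⟨⟨α, h, by simpa [Tcomp] using e⟩, rfl⟩
  · exact Subtype.ext (congrArg (fun γ : (Tcomp F).obj a ⟶ (Tcomp F).obj a' => γ.1) e)
  · let X : VObj F := ⟨b, a, inv β⟩
    obtain ⟨⟨a'⟩, ⟨i⟩⟩ := hT.mem_essImage X
    obtain ⟨α, h, e⟩ := i.inv
    change a ⟶ a' at α
    change b = F.obj a' at h
    subst h
    have e' : inv β ≫ F.map α = 𝟙 _ := e.trans (Category.comp_id _)
    rw [IsIso.inv_comp_eq, Category.comp_id] at e'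
    exact ⟨a', α, rfl, by rw [e', eqToHom_refl, Category.comp_id]⟩
  · obtain ⟨b, a, β⟩ := X
    obtain ⟨a', α, h, e⟩ := hF a (inv β)
    subst h
    rw [eqToHom_refl, Category.comp_id] at e
    let f : (⟨F.obj a', a, β⟩ : VObj F) ⟶ (Tcomp F).obj ⟨a'⟩ :=
      ⟨α, rfl, by simp [Tcomp, e]⟩
    exact ⟨⟨a'⟩, ⟨(asIso f).symm⟩⟩
end

section
/- Let A and B be groupoids with distinguished objects a⋆ and b⋆, and let F : A ⥤ B be a functor with F.obj a⋆ = b⋆. Let K(F) be the strong homotopy kernel of F, Ker F its kernel, and J : Ker F ⥤ K(F) the comparison functor sending (a, h) to (a, eqToHom h.symm). Then: (i) J is fully faithful; (ii) J is essentially surjective if and only if F is a ∗-fibration, i.e., for every object a of A and every morphism β : b⋆ ⟶ F.obj a there exist an object a' of A, an equality h : F.obj a' = b⋆, and a morphism α : a' ⟶ a with eqToHom h.symm ≫ F.map α = β. -/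
open CategoryTheory

variable {A B : Type*} [Groupoid A] [Groupoid B]

structure KObj (F : A ⥤ B) (b : B) where
  base : A
  hom : b ⟶ F.obj base

instance KObj.groupoid (F : A ⥤ B) (b : B) : Groupoid (KObj F b) where
  Hom X Y := { α : X.base ⟶ Y.base // X.hom ≫ F.map α = Y.hom }
  id X := ⟨𝟙 X.base, by simp⟩
  comp {X Y Z} α β := ⟨α.1 ≫ β.1, by
    rw [Functor.map_comp, ← Category.assoc, α.2, β.2]⟩
  id_comp α := Subtype.ext (Category.id_comp α.1)
  comp_id α := Subtype.ext (Category.comp_id α.1)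
  assoc α β γ := Subtype.ext (Category.assoc α.1 β.1 γ.1)
  inv {X Y} α := ⟨Groupoid.inv α.1, by
    rw [Groupoid.inv_eq_inv, Functor.map_inv, IsIso.comp_inv_eq]
    exact α.2.symm⟩
  inv_comp α := Subtype.ext (by simp [Groupoid.inv_eq_inv])
  comp_inv α := Subtype.ext (by simp [Groupoid.inv_eq_inv])

/-- Objects of the (strict) kernel of `F : A ⥤ B` at the base point `b`: pairs `(a, h)`
with `a` an object of `A` and `h : F.obj a = b`. -/
structure KerObj (F : A ⥤ B) (b : B) where
  base : A
  eq : F.obj base = b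

/-- The kernel groupoid: morphisms `(a, h) ⟶ (a', h')` are the morphisms `α : a ⟶ a'`
with `eqToHom h.symm ≫ F.map α ≫ eqToHom h' = 𝟙 b`. -/
instance KerObj.groupoid (F : A ⥤ B) (b : B) : Groupoid (KerObj F b) where
  Hom X Y := { α : X.base ⟶ Y.base // eqToHom X.eq.symm ≫ F.map α ≫ eqToHom Y.eq = 𝟙 b }
  id X := ⟨𝟙 X.base, by simp⟩
  comp {X Y Z} α β := ⟨α.1 ≫ β.1, by
    calc eqToHom X.eq.symm ≫ F.map (α.1 ≫ β.1) ≫ eqToHom Z.eq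
        = (eqToHom X.eq.symm ≫ F.map α.1 ≫ eqToHom Y.eq) ≫
            (eqToHom Y.eq.symm ≫ F.map β.1 ≫ eqToHom Z.eq) := by simp
      _ = 𝟙 b := by rw [α.2, β.2, Category.comp_id]⟩
  id_comp α := Subtype.ext (Category.id_comp α.1)
  comp_id α := Subtype.ext (Category.comp_id α.1)
  assoc α β γ := Subtype.ext (Category.assoc α.1 β.1 γ.1)
  inv {X Y} α := ⟨Groupoid.inv α.1, by
    have hm : F.map α.1 = eqToHom (X.eq.trans Y.eq.symm) := by
      simpa using congrArg (fun z => eqToHom X.eq ≫ z ≫ eqToHom Y.eq.symm) α.2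
    have hm2 : inv (F.map α.1) = eqToHom (Y.eq.trans X.eq.symm) := by
      apply IsIso.inv_eq_of_hom_inv_id
      rw [hm]; simp
    rw [Groupoid.inv_eq_inv, Functor.map_inv, hm2]
    simp⟩
  inv_comp α := Subtype.ext (by simp [Groupoid.inv_eq_inv])
  comp_inv α := Subtype.ext (by simp [Groupoid.inv_eq_inv])

/-- The comparison functor from the kernel to the strong homotopy kernel, sending
`(a, h)` to `(a, eqToHom h.symm)` and `α` to `α`. -/
def Jcomp (F : A ⥤ B) (b : B) : KerObj F b ⥤ KObj F b where
  obj X := ⟨X.base, eqToHom X.eq.symm⟩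
  map {X Y} α := ⟨α.1, by
    have hm : F.map α.1 = eqToHom (X.eq.trans Y.eq.symm) := by
      simpa using congrArg (fun z => eqToHom X.eq ≫ z ≫ eqToHom Y.eq.symm) α.2
    rw [hm]
    simp⟩
  map_id X := rfl
  map_comp α β := rfl

/-- For pointed groupoids and a pointed functor `F`, the comparison functor `J` from
the kernel of `F` to its strong homotopy kernel is fully faithful, and it is
essentially surjective if and only if `F` is a ∗-fibration. -/
theorem stmt5 {A B : Type*} [Groupoid A] [Groupoid B] (astar : A) (bstar : B)
    (F : A ⥤ B) (hF : F.obj astar = bstar) :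
    (Jcomp F bstar).Full ∧ (Jcomp F bstar).Faithful ∧
      ((Jcomp F bstar).EssSurj ↔
        ∀ (a : A) (β : bstar ⟶ F.obj a), ∃ (a' : A) (h : F.obj a' = bstar) (α : a' ⟶ a),
          eqToHom h.symm ≫ F.map α = β) := by
  refine ⟨⟨fun {X Y} α => ?_⟩, ⟨fun {X Y} α β h => ?_⟩,
    fun hJ a β => ?_, fun hfib => ⟨fun Y => ?_⟩⟩
  · let f : X.base ⟶ Y.base := α.1
    have hf : eqToHom X.eq.symm ≫ F.map f = eqToHom Y.eq.symm := α.2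
    refine ⟨⟨f, ?_⟩, rfl⟩
    rw [← Category.assoc, hf, eqToHom_trans, eqToHom_refl]
  · have hv : α.1 = β.1 := congrArg (fun γ : (Jcomp F bstar).obj X ⟶ _ => γ.1) h
    exact Subtype.ext hv
  · obtain ⟨X, ⟨i⟩⟩ := hJ.mem_essImage ⟨a, β⟩
    exact ⟨X.base, X.eq, i.hom.1, i.hom.2⟩
  · obtain ⟨a', h, α, hα⟩ := hfib Y.base Y.hom
    let f : (Jcomp F bstar).obj ⟨a', h⟩ ⟶ Y := ⟨α, hα⟩
    exact ⟨⟨a', h⟩, ⟨asIso f⟩⟩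
end
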